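/- Let (a, p) be a Walrasian equilibrium of the induced continuum economy. Write a(x) = a_0(x) ⊕ a_1(x) for x ∈ Ω0 and a(y) = a_0(y) ⊕ a_1(y) for y ∈ Ω1. Define the finite measure π̃1 on Ω0 × Ω1 by π̃1(A × B) := ∫_A a_1(x)(B ∩ N1(x)) dν0(x), let ν̃1 be the pushforward of π̃1 under the projection to Ω1, let G1 be any measurable probability kernel from Ω1 to Ω0 with G1(y, N0(y)) = 1 for every y ∈ Ω1, and set π1 := π̃1 + the measure determined by (A × B) ↦ ∫_B G1(y, A) d(ν1 − ν̃1)(y). Then ν̃1 ≤ ν1, π1 ∈ Π_1, and π1 is level-optimal maximin (from side 1 to side 0). Symmetrically, with π̃0(A × B) := ∫_B a_0(y)(A ∩ N0(y)) dν1(y), ν̃0 the pushforward of π̃0 under the projection to Ω0, and G0 any measurable probability kernel from Ω0 to Ω1 with G0(x, N1(x)) = 1 for every x ∈ Ω0, the plan π0 := π̃0 + ((A × B) ↦ ∫_A G0(x, B) d(ν0 − ν̃0)(x)) satisfies ν̃0 ≤ ν0, π0 ∈ Π_0, and π0 is level-optimal maximin (from side 0 to side 1). -/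

import Mathlib

/- STATEMENT 18: Extraction of a level-optimal maximin pair from a Walrasian equilibrium
(Theorem `walras_to_level_opt_refinement_pair`, with
Construction `extract_refinement_from_allocation`). -/

open MeasureTheory ProbabilityTheory Filter
open scoped ENNReal NNReal

noncomputable section

variable {Ω0 Ω1 : Type} [MeasurableSpace Ω0] [MeasurableSpace Ω1]

/-- Side-0 refinements: finite plans concentrated on `E` with first marginal `ν0`. -/
def Plans0 (E : Set (Ω0 × Ω1)) (ν0 : Measure Ω0) : Set (Measure (Ω0 × Ω1)) :=
  {π | IsFiniteMeasure π ∧ π Eᶜ = 0 ∧ π.map Prod.fst = ν0}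

/-- Side-1 refinements: finite plans concentrated on `E` with second marginal `ν1`. -/
def Plans1 (E : Set (Ω0 × Ω1)) (ν1 : Measure Ω1) : Set (Measure (Ω0 × Ω1)) :=
  {π | IsFiniteMeasure π ∧ π Eᶜ = 0 ∧ π.map Prod.snd = ν1}

/-- Capped feasible subplans for side-0 refinements (cap on side 1). -/
def Feas0 (E : Set (Ω0 × Ω1)) (ν0 : Measure Ω0) (ν1 : Measure Ω1) (t : ℝ) :
    Set (Measure (Ω0 × Ω1)) :=
  {σ | IsFiniteMeasure σ ∧ σ Eᶜ = 0 ∧ σ.map Prod.fst ≤ ν0 ∧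
    σ.map Prod.snd ≤ (ENNReal.ofReal t) • ν1}

def Fit0 (E : Set (Ω0 × Ω1)) (ν0 : Measure Ω0) (ν1 : Measure Ω1) (t : ℝ) : ℝ≥0∞ :=
  ⨆ σ ∈ Feas0 E ν0 ν1 t, σ Set.univ

/-- Level-optimal maximin from side 0 to side 1. -/
def LevelOpt0 (E : Set (Ω0 × Ω1)) (ν0 : Measure Ω0) (ν1 : Measure Ω1)
    (π : Measure (Ω0 × Ω1)) : Prop :=
  ∀ t : ℝ, 0 < t →
    ∫⁻ y, min ((π.map Prod.snd).rnDeriv ν1 y) (ENNReal.ofReal t) ∂ν1 = Fit0 E ν0 ν1 t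

/-- Capped feasible subplans for side-1 refinements (cap on side 0). -/
def Feas1 (E : Set (Ω0 × Ω1)) (ν0 : Measure Ω0) (ν1 : Measure Ω1) (t : ℝ) :
    Set (Measure (Ω0 × Ω1)) :=
  {σ | IsFiniteMeasure σ ∧ σ Eᶜ = 0 ∧ σ.map Prod.snd ≤ ν1 ∧
    σ.map Prod.fst ≤ (ENNReal.ofReal t) • ν0}

def Fit1 (E : Set (Ω0 × Ω1)) (ν0 : Measure Ω0) (ν1 : Measure Ω1) (t : ℝ) : ℝ≥0∞ :=
  ⨆ σ ∈ Feas1 E ν0 ν1 t, σ Set.univ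

/-- Level-optimal maximin from side 1 to side 0. -/
def LevelOpt1 (E : Set (Ω0 × Ω1)) (ν0 : Measure Ω0) (ν1 : Measure Ω1)
    (π : Measure (Ω0 × Ω1)) : Prop :=
  ∀ t : ℝ, 0 < t →
    ∫⁻ x, min ((π.map Prod.fst).rnDeriv ν0 x) (ENNReal.ofReal t) ∂ν0 = Fit1 E ν0 ν1 t

/-- The agent measure `μ = ν0 ⊕ ν1` on `T = Ω0 ⊔ Ω1`. -/
def muT (ν0 : Measure Ω0) (ν1 : Measure Ω1) : Measure (Ω0 ⊕ Ω1) :=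
  ν0.map Sum.inl + ν1.map Sum.inr

/-- Utility of a bundle `z` for agent `t`: the mass of `z` on the opposite-side neighbors. -/
def util (E : Set (Ω0 × Ω1)) (t : Ω0 ⊕ Ω1) (z : Measure (Ω0 ⊕ Ω1)) : ℝ≥0∞ :=
  match t with
  | Sum.inl x => (z.comap Sum.inr) {y : Ω1 | (x, y) ∈ E}
  | Sum.inr y => (z.comap Sum.inl) {x : Ω0 | (x, y) ∈ E}

/-- Consumption set of agent `t`: a bundle may retain own-side mass only on the agent itself,
and opposite-side mass only on the agent's neighbors. -/
def ConsSet (E : Set (Ω0 × Ω1)) (t : Ω0 ⊕ Ω1) : Set (Measure (Ω0 ⊕ Ω1)) :=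
  match t with
  | Sum.inl x => {z | (z.comap Sum.inl) {x}ᶜ = 0 ∧ (z.comap Sum.inr) {y : Ω1 | (x, y) ∈ E}ᶜ = 0}
  | Sum.inr y => {z | (z.comap Sum.inr) {y}ᶜ = 0 ∧ (z.comap Sum.inl) {x : Ω0 | (x, y) ∈ E}ᶜ = 0}

/-- Allocations of the induced continuum economy. -/
def IsAllocation (E : Set (Ω0 × Ω1)) (ν0 : Measure Ω0) (ν1 : Measure Ω1)
    (a : (Ω0 ⊕ Ω1) → Measure (Ω0 ⊕ Ω1)) : Prop :=
  (∀ t, IsFiniteMeasure (a t)) ∧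
  (∀ f : (Ω0 ⊕ Ω1) → ℝ, Measurable f → (∃ C : ℝ, ∀ t, |f t| ≤ C) →
    Measurable fun t => ∫ s, f s ∂(a t)) ∧
  (∀ᵐ t ∂(muT ν0 ν1), a t ∈ ConsSet E t)

/-- Feasibility of an allocation. -/
def FeasibleAlloc (ν0 : Measure Ω0) (ν1 : Measure Ω1)
    (a : (Ω0 ⊕ Ω1) → Measure (Ω0 ⊕ Ω1)) : Prop :=
  ∀ B : Set (Ω0 ⊕ Ω1), MeasurableSet B → ∫⁻ t, a t B ∂(muT ν0 ν1) = (muT ν0 ν1) B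

/-- Prices: bounded measurable `[0,∞)`-valued functions on the agent space. -/
def IsPrice (p : (Ω0 ⊕ Ω1) → ℝ≥0∞) : Prop :=
  Measurable p ∧ ∃ C : ℝ≥0∞, C ≠ ⊤ ∧ ∀ t, p t ≤ C

/-- Walrasian equilibrium of the induced continuum economy. -/
def Walras (E : Set (Ω0 × Ω1)) (ν0 : Measure Ω0) (ν1 : Measure Ω1)
    (a : (Ω0 ⊕ Ω1) → Measure (Ω0 ⊕ Ω1)) (p : (Ω0 ⊕ Ω1) → ℝ≥0∞) : Prop :=
  IsAllocation E ν0 ν1 a ∧ FeasibleAlloc ν0 ν1 a ∧ IsPrice p ∧ p ≠ 0 ∧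
  ∀ᵐ t ∂(muT ν0 ν1),
    (∫⁻ s, p s ∂(a t)) ≤ p t ∧
    ¬ ∃ z ∈ ConsSet E t, (∫⁻ s, p s ∂z) ≤ p t ∧ util E t (a t) < util E t z

/-- The graph-compatible traded part `π̃1`, with `π̃1(A × B) = ∫_A a_1(x)(B ∩ N1 x) dν0(x)`. -/
def tildePi1 (E : Set (Ω0 × Ω1)) (ν0 : Measure Ω0)
    (a : (Ω0 ⊕ Ω1) → Measure (Ω0 ⊕ Ω1)) : Measure (Ω0 × Ω1) :=
  ν0.bind (fun x =>
    ((((a (Sum.inl x)).comap Sum.inr).restrict {y : Ω1 | (x, y) ∈ E}).map (fun y => (x, y))))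

/-- The extracted side-1 refinement `π1 = π̃1 + (ν1 − ν̃1) ⋈ G1`. -/
def extractPi1 (E : Set (Ω0 × Ω1)) (ν0 : Measure Ω0) (ν1 : Measure Ω1)
    (a : (Ω0 ⊕ Ω1) → Measure (Ω0 ⊕ Ω1)) (G1 : Kernel Ω1 Ω0) : Measure (Ω0 × Ω1) :=
  tildePi1 E ν0 a
    + (ν1 - (tildePi1 E ν0 a).map Prod.snd).bind (fun y => (G1 y).map (fun x => (x, y)))

/-- The graph-compatible traded part `π̃0`, with `π̃0(A × B) = ∫_B a_0(y)(A ∩ N0 y) dν1(y)`. -/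
def tildePi0 (E : Set (Ω0 × Ω1)) (ν1 : Measure Ω1)
    (a : (Ω0 ⊕ Ω1) → Measure (Ω0 ⊕ Ω1)) : Measure (Ω0 × Ω1) :=
  ν1.bind (fun y =>
    ((((a (Sum.inr y)).comap Sum.inl).restrict {x : Ω0 | (x, y) ∈ E}).map (fun x => (x, y))))

/-- The extracted side-0 refinement `π0 = π̃0 + (ν0 − ν̃0) ⋈ G0`. -/
def extractPi0 (E : Set (Ω0 × Ω1)) (ν0 : Measure Ω0) (ν1 : Measure Ω1)
    (a : (Ω0 ⊕ Ω1) → Measure (Ω0 ⊕ Ω1)) (G0 : Kernel Ω0 Ω1) : Measure (Ω0 × Ω1) :=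
  tildePi0 E ν1 a
    + (ν0 - (tildePi0 E ν1 a).map Prod.fst).bind (fun x => (G0 x).map (fun y => (x, y)))

namespace TradingEconomy

variable {X Y : Type} [MeasurableSpace X] [MeasurableSpace Y]

/-- One side of an equilibrium of the bipartite trading economy with edge set `E`: agents `x : X`
hold one unit of a good priced `p x`, retain the amount `s x` of it and buy the bundle `κ x` of
goods in `Y`, priced by `q`; agents `y : Y` retain the amount `s' y` of their own good. -/
structure OptimalSide (E : Set (X × Y)) (μ : Measure X) (ν : Measure Y) (p : X → ℝ≥0∞)
    (q : Y → ℝ≥0∞) (κ : Kernel X Y) (s : X → ℝ≥0∞) (s' : Y → ℝ≥0∞) : Prop where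
  measurableSet : MeasurableSet E
  exists_mem : ∀ x, ∃ y, (x, y) ∈ E
  measurable_price : Measurable p
  price_bdd : ∃ C : ℝ≥0∞, C ≠ ⊤ ∧ ∀ x, p x ≤ C
  finite : ∀ x, κ x Set.univ ≠ ⊤
  budget : ∀ᵐ x ∂μ, s x * p x + ∫⁻ y, q y ∂(κ x) ≤ p x
  support : ∀ᵐ x ∂μ, ∀ᵐ y ∂(κ x), (x, y) ∈ E
  optimal : ∀ᵐ x ∂μ, ∀ y, (x, y) ∈ E → ∀ c : ℝ≥0∞, c * q y ≤ p x → c ≤ κ x Set.univ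
  clearing : ∀ B, MeasurableSet B → ∫⁻ x, κ x B ∂μ + ∫⁻ y in B, s' y ∂ν = ν B

namespace OptimalSide

variable {E : Set (X × Y)} {μ : Measure X} {ν : Measure Y} {p : X → ℝ≥0∞} {q : Y → ℝ≥0∞}
  {κ : Kernel X Y} {κ' : Kernel Y X} {s : X → ℝ≥0∞} {s' : Y → ℝ≥0∞}

lemma price_ne_top (h : OptimalSide E μ ν p q κ s s') (x : X) : p x ≠ ⊤ := by
  obtain ⟨C, hC, hp⟩ := h.price_bdd
  exact ne_top_of_le_ne_top hC (hp x)

lemma ae_price_ne_zero (h : OptimalSide E μ ν p q κ s s') :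
    ∀ᵐ x ∂μ, ∀ y, (x, y) ∈ E → q y ≠ 0 := by
  filter_upwards [h.optimal] with x hx y hxy hq
  exact h.finite x (top_le_iff.1 (hx y hxy ⊤ (by simp [hq])))

lemma ae_price_le (h : OptimalSide E μ ν p q κ s s') (hq : ∀ y, q y ≠ ⊤) :
    ∀ᵐ x ∂μ, ∀ y, (x, y) ∈ E → p x ≤ κ x Set.univ * q y := by
  filter_upwards [h.optimal, h.ae_price_ne_zero] with x hx h0 y hxy
  have hc := hx y hxy (p x / q y) (ENNReal.div_mul_cancel (h0 y hxy) (hq y)).le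
  calc p x = p x / q y * q y := (ENNReal.div_mul_cancel (h0 y hxy) (hq y)).symm
    _ ≤ _ := by gcongr

lemma ae_spending (h : OptimalSide E μ ν p q κ s s') (hqm : Measurable q)
    (hq : ∀ y, q y ≠ ⊤) :
    ∀ᵐ x ∂μ, ∫⁻ y, q y ∂(κ x) = p x ∧ s x * p x = 0 ∧
      ∀ᵐ y ∂(κ x), p x = κ x Set.univ * q y := by
  filter_upwards [h.budget, h.support, h.ae_price_le hq] with x hb hs hle
  have hbq : ∫⁻ y, q y ∂(κ x) ≤ p x := le_trans le_add_self hb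
  have hle' : (fun _ => p x) ≤ᵐ[κ x] fun y => κ x Set.univ * q y := by
    filter_upwards [hs] with y hy using hle y hy
  have hspend : ∫⁻ y, q y ∂(κ x) = p x := by
    refine le_antisymm hbq ?_
    rcases eq_or_ne (κ x Set.univ) 0 with h0 | h0
    · obtain ⟨y, hy⟩ := h.exists_mem x
      have := hle y hy
      rw [h0, zero_mul] at this
      exact this.trans zero_le
    · have := lintegral_mono_ae hle'
      rw [lintegral_const, lintegral_const_mul _ hqm, mul_comm] at this
      exact (ENNReal.mul_le_mul_iff_right h0 (h.finite x)).1 this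
  refine ⟨hspend, ?_, ?_⟩
  · rw [hspend] at hb
    have : s x * p x + p x ≤ 0 + p x := by simpa using hb
    exact nonpos_iff_eq_zero.1 ((ENNReal.add_le_add_iff_right (h.price_ne_top x)).1 this)
  · refine ae_eq_of_ae_le_of_lintegral_le hle' ?_ (hqm.const_mul _).aemeasurable ?_
    · rw [lintegral_const]
      exact ENNReal.mul_ne_top (h.price_ne_top x) (h.finite x)
    · rw [lintegral_const, lintegral_const_mul _ hqm, hspend, mul_comm]

lemma measurable_mass : Measurable fun x => κ x Set.univ := κ.measurable_coe .univ

lemma ae_compProd_mem (h : OptimalSide E μ ν p q κ s s') : ∀ᵐ z ∂(μ ⊗ₘ κ), z ∈ E :=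
  Measure.ae_compProd_of_ae_ae h.measurableSet h.support

lemma ae_compProd_of_ae_fst {r : X → Prop} (h : ∀ᵐ x ∂μ, r x) :
    ∀ᵐ z ∂(μ ⊗ₘ κ), r z.1 := by
  obtain ⟨N, hN, hNm, hN0⟩ := exists_measurable_superset_of_null (ae_iff.1 h)
  have h' : ∀ᵐ x ∂μ, x ∉ N := measure_eq_zero_iff_ae_notMem.1 hN0
  filter_upwards [Measure.ae_compProd_of_ae_fst κ (p := fun x => x ∉ N) hNm.compl h'] with z hz
  by_contra hr
  exact hz (hN hr)

section Plan

variable [SFinite μ] [IsSFiniteKernel κ]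

lemma map_snd_compProd_apply {B : Set Y} (hB : MeasurableSet B) :
    ((μ ⊗ₘ κ).map Prod.snd) B = ∫⁻ x, κ x B ∂μ := by
  rw [Measure.map_apply measurable_snd hB, Measure.compProd_apply (measurable_snd hB)]
  rfl

lemma map_fst_compProd : (μ ⊗ₘ κ).map Prod.fst = μ.withDensity fun x => κ x Set.univ := by
  ext A hA
  rw [Measure.map_apply measurable_fst hA, withDensity_apply _ hA, ← Set.prod_univ,
    Measure.compProd_apply_prod hA .univ]

lemma map_snd_compProd (h : OptimalSide E μ ν p q κ s s')
    (h' : OptimalSide (Prod.swap ⁻¹' E) ν μ q p κ' s' s) :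
    (μ ⊗ₘ κ).map Prod.snd = ν.restrict {y | q y ≠ 0} := by
  have hpos : MeasurableSet {y | q y ≠ 0} := (h'.measurable_price (measurableSet_singleton 0)).compl
  ext B hB
  rw [map_snd_compProd_apply hB, Measure.restrict_apply hB]
  have hret : ∫⁻ y in B ∩ {y | q y ≠ 0}, s' y ∂ν = 0 := by
    refine (setLIntegral_congr_fun_ae (g := fun _ => 0) (hB.inter hpos) ?_).trans lintegral_zero
    filter_upwards [h'.ae_spending h.measurable_price h.price_ne_top] with y hy hyB
    exact (mul_eq_zero.1 hy.2.1).resolve_right hyB.2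
  rw [← h.clearing _ (hB.inter hpos), hret, add_zero]
  refine lintegral_congr_ae ?_
  filter_upwards [h.support, h.ae_price_ne_zero] with x hs h0
  refine measure_congr ?_
  filter_upwards [hs] with y hy
  exact propext ⟨fun hyB => ⟨hyB, h0 y hy⟩, fun hyB => hyB.1⟩

lemma map_snd_compProd_le (h : OptimalSide E μ ν p q κ s s')
    (h' : OptimalSide (Prod.swap ⁻¹' E) ν μ q p κ' s' s) :
    (μ ⊗ₘ κ).map Prod.snd ≤ ν := by
  rw [h.map_snd_compProd h']
  exact Measure.restrict_le_self

lemma ae_compProd_of_ae_snd (h : OptimalSide E μ ν p q κ s s')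
    (h' : OptimalSide (Prod.swap ⁻¹' E) ν μ q p κ' s' s) {r : Y → Prop}
    (hr : ∀ᵐ y ∂ν, r y) : ∀ᵐ z ∂(μ ⊗ₘ κ), r z.2 :=
  ae_of_ae_map measurable_snd.aemeasurable
    ((Measure.absolutelyContinuous_of_le (h.map_snd_compProd_le h')).ae_le hr)

lemma lintegral_fst_mul_price (h : OptimalSide E μ ν p q κ s s') (hqm : Measurable q)
    (hq : ∀ y, q y ≠ ⊤) {f : X → ℝ≥0∞} (hf : Measurable f) :
    ∫⁻ z, f z.1 * q z.2 ∂(μ ⊗ₘ κ) = ∫⁻ x, f x * p x ∂μ := by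
  rw [Measure.lintegral_compProd (by fun_prop)]
  refine lintegral_congr_ae ?_
  filter_upwards [h.ae_spending hqm hq] with x hx
  rw [lintegral_const_mul _ hqm, hx.1]

lemma lintegral_snd_mul_price (h : OptimalSide E μ ν p q κ s s')
    (h' : OptimalSide (Prod.swap ⁻¹' E) ν μ q p κ' s' s) {f : Y → ℝ≥0∞} (hf : Measurable f) :
    ∫⁻ z, f z.2 * q z.2 ∂(μ ⊗ₘ κ) = ∫⁻ y, f y * q y ∂ν := by
  have hqm := h'.measurable_price
  have hpos : MeasurableSet {y | q y ≠ 0} := (hqm (measurableSet_singleton 0)).compl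
  rw [← lintegral_map (f := fun y => f y * q y) (by fun_prop) measurable_snd,
    h.map_snd_compProd h', ← lintegral_indicator hpos]
  refine lintegral_congr fun y => ?_
  by_cases hy : q y = 0 <;> simp [Set.indicator, hy]

/-- Money spent circulates: along traded edges the utilities of buyer and seller are reciprocal. -/
lemma ae_mass_mul_mass_eq_one [IsFiniteMeasure μ] [IsFiniteMeasure ν] [IsSFiniteKernel κ']
    (h : OptimalSide E μ ν p q κ s s')
    (h' : OptimalSide (Prod.swap ⁻¹' E) ν μ q p κ' s' s) :
    ∀ᵐ z ∂(μ ⊗ₘ κ), κ z.1 Set.univ * κ' z.2 Set.univ = 1 := by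
  have hpm := h.measurable_price
  have hqm := h'.measurable_price
  have hvm : Measurable fun y => κ' y Set.univ := measurable_mass
  set m : Y → ℝ≥0∞ := fun y => q y / κ' y Set.univ with hm
  have hmm : Measurable m := hqm.div hvm
  have hq0 : ∀ᵐ z ∂(μ ⊗ₘ κ), q z.2 ≠ 0 := by
    filter_upwards [h.ae_compProd_mem, ae_compProd_of_ae_fst h.ae_price_ne_zero] with z hz h0
    exact h0 z.2 hz
  have hle : ∀ᵐ z ∂(μ ⊗ₘ κ), q z.2 ≤ κ' z.2 Set.univ * p z.1 := by
    filter_upwards [h.ae_compProd_mem,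
      h.ae_compProd_of_ae_snd h' (h'.ae_price_le h.price_ne_top)] with z hz hle
    exact hle z.1 hz
  have hsq : ∫⁻ z, p z.1 * q z.2 ∂(μ ⊗ₘ κ) = ∫⁻ x, p x * p x ∂μ :=
    h.lintegral_fst_mul_price hqm h'.price_ne_top hpm
  have hfin : ∫⁻ x, p x * p x ∂μ ≠ ⊤ := by
    obtain ⟨C, hC, hp⟩ := h.price_bdd
    refine ne_top_of_le_ne_top (b := ∫⁻ _, C * C ∂μ) ?_ (lintegral_mono fun x => ?_)
    · rw [lintegral_const]
      exact ENNReal.mul_ne_top (ENNReal.mul_ne_top hC hC) (measure_ne_top _ _)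
    · exact mul_le_mul' (hp x) (hp x)
  have hsq' : ∫⁻ x, p x * p x ∂μ = ∫⁻ z, m z.2 * q z.2 ∂(μ ⊗ₘ κ) := by
    have hE : Prod.swap ⁻¹' (Prod.swap ⁻¹' E) = E := by ext; rfl
    rw [h.lintegral_snd_mul_price h' hmm, ← h'.lintegral_fst_mul_price hpm h.price_ne_top hmm,
      ← h'.lintegral_snd_mul_price (by rw [hE]; exact h) hpm]
    refine lintegral_congr_ae ?_
    have hx : ∀ᵐ z ∂(ν ⊗ₘ κ'), ∀ y, (z.2, y) ∈ E → q y ≠ 0 :=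
      h'.ae_compProd_of_ae_snd (by rw [hE]; exact h) h.ae_price_ne_zero
    have hy : ∀ᵐ z ∂(ν ⊗ₘ κ'), q z.1 = κ' z.1 Set.univ * p z.2 :=
      Measure.ae_compProd_of_ae_ae (measurableSet_eq_fun (by fun_prop) (by fun_prop))
        ((h'.ae_spending hpm h.price_ne_top).mono fun y hy => hy.2.2)
    filter_upwards [h'.ae_compProd_mem, hx, hy] with z hz hx hy
    have hv : κ' z.1 Set.univ ≠ 0 := fun h0 => hx z.1 hz (by rw [hy, h0, zero_mul])
    have : m z.1 = p z.2 := by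
      rw [hm]
      simp only
      rw [hy, mul_comm, ENNReal.mul_div_cancel_right hv (h'.finite _)]
    rw [this]
  have hae : (fun z : X × Y => m z.2 * q z.2) =ᵐ[μ ⊗ₘ κ] fun z => p z.1 * q z.2 := by
    refine ae_eq_of_ae_le_of_lintegral_le ?_ (by rwa [← hsq'])
      (by fun_prop) (by rw [hsq, hsq'])
    filter_upwards [hle] with z hz
    gcongr
    exact ENNReal.div_le_of_le_mul' hz
  have hbuy : ∀ᵐ z ∂(μ ⊗ₘ κ), p z.1 = κ z.1 Set.univ * q z.2 :=
    Measure.ae_compProd_of_ae_ae (measurableSet_eq_fun (by fun_prop)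
      ((measurable_mass.comp measurable_fst).mul (by fun_prop)))
      ((h.ae_spending hqm h'.price_ne_top).mono fun x hx => hx.2.2)
  filter_upwards [hae, hq0, hle, hbuy] with z hz hq hle hbuy
  have hqt := h'.price_ne_top z.2
  have hv : κ' z.2 Set.univ ≠ 0 := fun h0 => hq (by simpa [h0] using hle)
  have hmp : m z.2 = p z.1 := (ENNReal.mul_left_inj hq hqt).1 hz
  have hqv : q z.2 = p z.1 * κ' z.2 Set.univ := by
    rw [← hmp]
    exact (ENNReal.div_mul_cancel hv (h'.finite _)).symm
  refine (ENNReal.mul_left_inj hq hqt).1 ?_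
  rw [one_mul]
  nth_rw 2 [hqv]
  rw [hbuy]
  ring

lemma measure_univ_le_of_mem_Feas1 [IsFiniteMeasure μ] [IsFiniteMeasure ν] [IsSFiniteKernel κ']
    (h : OptimalSide E μ ν p q κ s s')
    (h' : OptimalSide (Prod.swap ⁻¹' E) ν μ q p κ' s' s) {t : ℝ} {σ : Measure (X × Y)}
    (hσ : σ ∈ Feas1 E μ ν t) :
    σ Set.univ ≤ ∫⁻ x, min (κ x Set.univ) (ENNReal.ofReal t) ∂μ := by
  obtain ⟨-, hσE, hσ1, hσ0⟩ := hσ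
  set c := ENNReal.ofReal t
  have hum : Measurable fun x => κ x Set.univ := measurable_mass
  have hvm : Measurable fun y => κ' y Set.univ := measurable_mass
  have hA : MeasurableSet {x | c ≤ κ x Set.univ} := measurableSet_le measurable_const hum
  have hT : MeasurableSet {y | 1 < c * κ' y Set.univ} :=
    measurableSet_lt measurable_const (hvm.const_mul _)
  have hpos : MeasurableSet {y | q y ≠ 0} :=
    (h'.measurable_price (measurableSet_singleton 0)).compl
  have hac0 : σ.map Prod.fst ≪ μ :=
    (Measure.absolutelyContinuous_of_le hσ0).trans Measure.smul_absolutelyContinuous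
  have hac1 : σ.map Prod.snd ≪ ν := Measure.absolutelyContinuous_of_le hσ1
  have hrich : σ (Prod.fst ⁻¹' {x | c ≤ κ x Set.univ}) ≤
      ∫⁻ x in {x | c ≤ κ x Set.univ}, min (κ x Set.univ) c ∂μ := by
    rw [← Measure.map_apply measurable_fst hA]
    refine (hσ0 _).trans_eq ?_
    rw [setLIntegral_congr_fun hA (g := fun _ => c) fun x hx => min_eq_right hx]
    simp
  have hpoor : σ (Prod.fst ⁻¹' {x | c ≤ κ x Set.univ}ᶜ) ≤
      ∫⁻ x in {x | c ≤ κ x Set.univ}ᶜ, min (κ x Set.univ) c ∂μ := by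
    have hsub : (Prod.fst ⁻¹' {x | c ≤ κ x Set.univ}ᶜ : Set (X × Y)) ≤ᵐ[σ]
        Prod.snd ⁻¹' ({y | 1 < c * κ' y Set.univ} ∩ {y | q y ≠ 0}) := by
      filter_upwards [measure_eq_zero_iff_ae_notMem.1 hσE,
        ae_of_ae_map measurable_fst.aemeasurable (hac0.ae_le h.ae_price_ne_zero),
        ae_of_ae_map measurable_fst.aemeasurable (hac0.ae_le (h.ae_price_le h'.price_ne_top)),
        ae_of_ae_map measurable_snd.aemeasurable (hac1.ae_le (h'.ae_price_le h.price_ne_top))]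
        with z hzE hq hpu hqv hz
      have hzE : z ∈ E := not_not.1 hzE
      replace hq : q z.2 ≠ 0 := hq z.2 hzE
      replace hz : κ z.1 Set.univ < c := not_le.1 hz
      have hqt := h'.price_ne_top z.2
      have hqv' : q z.2 ≤ κ' z.2 Set.univ * p z.1 := hqv z.1 hzE
      have hv : κ' z.2 Set.univ ≠ 0 := fun h0 => hq (by simpa [h0] using hqv')
      have huv : 1 ≤ κ z.1 Set.univ * κ' z.2 Set.univ := by
        refine (ENNReal.mul_le_mul_iff_left hq hqt).1 ?_
        calc 1 * q z.2 ≤ κ' z.2 Set.univ * p z.1 := by rwa [one_mul]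
          _ ≤ κ' z.2 Set.univ * (κ z.1 Set.univ * q z.2) := by gcongr; exact hpu z.2 hzE
          _ = _ := by ring
      exact ⟨huv.trans_lt ((ENNReal.mul_lt_mul_iff_left hv (h'.finite _)).2 hz), hq⟩
    calc σ (Prod.fst ⁻¹' {x | c ≤ κ x Set.univ}ᶜ)
        ≤ σ (Prod.snd ⁻¹' ({y | 1 < c * κ' y Set.univ} ∩ {y | q y ≠ 0})) := measure_mono_ae hsub
      _ = σ.map Prod.snd ({y | 1 < c * κ' y Set.univ} ∩ {y | q y ≠ 0}) :=
          (Measure.map_apply measurable_snd (hT.inter hpos)).symm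
      _ ≤ ν ({y | 1 < c * κ' y Set.univ} ∩ {y | q y ≠ 0}) := hσ1 _
      _ = (μ ⊗ₘ κ).map Prod.snd {y | 1 < c * κ' y Set.univ} := by
          rw [h.map_snd_compProd h', Measure.restrict_apply hT]
      _ = (μ ⊗ₘ κ) (Prod.snd ⁻¹' {y | 1 < c * κ' y Set.univ}) :=
          Measure.map_apply measurable_snd hT
      _ ≤ (μ ⊗ₘ κ) (Prod.fst ⁻¹' {x | c ≤ κ x Set.univ}ᶜ) := by
          refine measure_mono_ae ?_
          filter_upwards [h.ae_mass_mul_mass_eq_one h'] with z hz hzT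
          replace hzT : 1 < c * κ' z.2 Set.univ := hzT
          refine fun (hc : c ≤ κ z.1 Set.univ) => ?_
          rw [← hz] at hzT
          exact hzT.not_ge (by gcongr)
      _ = (μ ⊗ₘ κ).map Prod.fst {x | c ≤ κ x Set.univ}ᶜ :=
          (Measure.map_apply measurable_fst hA.compl).symm
      _ = ∫⁻ x in {x | c ≤ κ x Set.univ}ᶜ, min (κ x Set.univ) c ∂μ := by
          rw [map_fst_compProd, withDensity_apply _ hA.compl]
          exact setLIntegral_congr_fun hA.compl fun x hx =>
            (min_eq_left (lt_of_not_ge (Set.notMem_ofPred_iff.1 hx)).le).symm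
  calc σ Set.univ = σ (Prod.fst ⁻¹' {x | c ≤ κ x Set.univ}) +
        σ (Prod.fst ⁻¹' {x | c ≤ κ x Set.univ}ᶜ) := by
        rw [Set.preimage_compl, measure_add_measure_compl (measurable_fst hA)]
    _ ≤ _ := add_le_add hrich hpoor
    _ = _ := lintegral_add_compl _ hA

lemma exists_mem_Feas1 [IsFiniteMeasure μ] (h : OptimalSide E μ ν p q κ s s')
    (h' : OptimalSide (Prod.swap ⁻¹' E) ν μ q p κ' s' s) (t : ℝ) :
    ∃ σ ∈ Feas1 E μ ν t, σ Set.univ = ∫⁻ x, min (κ x Set.univ) (ENNReal.ofReal t) ∂μ := by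
  set c := ENNReal.ofReal t
  have hum : Measurable fun x => κ x Set.univ := measurable_mass
  set w : X → ℝ≥0∞ := fun x => min (κ x Set.univ) c / κ x Set.univ with hw
  have hwm : Measurable w := (hum.min measurable_const).div hum
  have hw1 : ∀ x, w x ≤ 1 := fun x =>
    ENNReal.div_le_of_le_mul (by rw [one_mul]; exact min_le_left _ _)
  have hwu : ∀ x, w x * κ x Set.univ = min (κ x Set.univ) c := fun x => by
    rcases eq_or_ne (κ x Set.univ) 0 with h0 | h0
    · simp [h0]
    · exact ENNReal.div_mul_cancel h0 (h.finite x)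
  have hfst : ∀ A, MeasurableSet A →
      ((μ ⊗ₘ κ).withDensity fun z => w z.1).map Prod.fst A =
        ∫⁻ x in A, min (κ x Set.univ) c ∂μ := fun A hA => by
    rw [Measure.map_apply measurable_fst hA, withDensity_apply _ (measurable_fst hA),
      ← Set.prod_univ, Measure.setLIntegral_compProd (by fun_prop) hA .univ]
    simp [hwu]
  have huniv : ((μ ⊗ₘ κ).withDensity fun z => w z.1) Set.univ =
      ∫⁻ x, min (κ x Set.univ) c ∂μ := by
    rw [← setLIntegral_univ, ← hfst _ .univ, Measure.map_apply measurable_fst .univ,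
      Set.preimage_univ]
  have hcap : ∀ A, ∫⁻ x in A, min (κ x Set.univ) c ∂μ ≤ c * μ A := fun A => by
    rw [← setLIntegral_const]
    exact lintegral_mono fun x => min_le_right _ _
  refine ⟨(μ ⊗ₘ κ).withDensity fun z => w z.1, ⟨⟨?_⟩, ?_, ?_, ?_⟩, huniv⟩
  · rw [huniv, ← setLIntegral_univ]
    exact (hcap _).trans_lt (ENNReal.mul_lt_top ENNReal.ofReal_lt_top (measure_lt_top _ _))
  · exact withDensity_absolutelyContinuous _ _ (ae_iff.1 h.ae_compProd_mem)
  · refine le_trans (Measure.map_mono ?_ measurable_snd) (h.map_snd_compProd_le h')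
    calc _ ≤ (μ ⊗ₘ κ).withDensity 1 := withDensity_mono (ae_of_all _ fun z => hw1 z.1)
      _ = _ := withDensity_one
  · refine Measure.le_iff.2 fun A hA => ?_
    rw [hfst A hA]
    exact hcap A

lemma Fit1_eq [IsFiniteMeasure μ] [IsFiniteMeasure ν] [IsSFiniteKernel κ']
    (h : OptimalSide E μ ν p q κ s s')
    (h' : OptimalSide (Prod.swap ⁻¹' E) ν μ q p κ' s' s) (t : ℝ) :
    Fit1 E μ ν t = ∫⁻ x, min (κ x Set.univ) (ENNReal.ofReal t) ∂μ := by
  refine le_antisymm (iSup₂_le fun σ hσ => h.measure_univ_le_of_mem_Feas1 h' hσ) ?_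
  obtain ⟨σ, hσ, hσu⟩ := h.exists_mem_Feas1 h' t
  rw [← hσu]
  exact le_iSup₂ (f := fun (σ : Measure (X × Y)) (_ : σ ∈ Feas1 E μ ν t) => σ Set.univ) σ hσ

lemma extract_mem_Plans1_and_levelOpt1 [IsFiniteMeasure μ] [IsFiniteMeasure ν]
    [IsSFiniteKernel κ'] (h : OptimalSide E μ ν p q κ s s')
    (h' : OptimalSide (Prod.swap ⁻¹' E) ν μ q p κ' s' s) (G : Kernel Y X) [IsMarkovKernel G]
    (hG : ∀ y, G y {x | (x, y) ∈ E} = 1) :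
    μ ⊗ₘ κ + ((ν - (μ ⊗ₘ κ).map Prod.snd) ⊗ₘ G).map Prod.swap ∈ Plans1 E ν ∧
      LevelOpt1 E μ ν (μ ⊗ₘ κ + ((ν - (μ ⊗ₘ κ).map Prod.snd) ⊗ₘ G).map Prod.swap) := by
  have hpos : MeasurableSet {y | q y ≠ 0} :=
    (h'.measurable_price (measurableSet_singleton 0)).compl
  have hsplit : ν.restrict {y | q y ≠ 0}ᶜ + ν.restrict {y | q y ≠ 0} = ν :=
    Measure.restrict_compl_add_restrict hpos
  have hrest : ν - (μ ⊗ₘ κ).map Prod.snd = ν.restrict {y | q y ≠ 0}ᶜ := by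
    rw [h.map_snd_compProd h']
    nth_rw 1 [← hsplit]
    exact Measure.add_sub_cancel
  rw [hrest]
  set ρ := ν.restrict {y | q y ≠ 0}ᶜ
  set R := (ρ ⊗ₘ G).map Prod.swap with hR
  have hGE : ∀ y, ∀ᵐ x ∂(G y), (x, y) ∈ E := fun y => by
    have hm : MeasurableSet {x | (x, y) ∈ E} := measurable_prodMk_right h.measurableSet
    exact (prob_compl_eq_zero_iff hm).2 (hG y)
  have hRE : ∀ᵐ z ∂(ρ ⊗ₘ G), z.swap ∈ E :=
    Measure.ae_compProd_of_ae_ae (measurable_swap h.measurableSet) (ae_of_all _ hGE)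
  have hRsnd : R.map Prod.snd = ρ := by
    rw [hR, Measure.map_map measurable_snd measurable_swap]
    exact Measure.fst_compProd ρ G
  have hsnd : (μ ⊗ₘ κ + R).map Prod.snd = ν := by
    rw [Measure.map_add _ _ measurable_snd, hRsnd, h.map_snd_compProd h', add_comm, hsplit]
  have hsing : R.map Prod.fst ⟂ₘ μ := by
    obtain ⟨N, hN, hNm, hN0⟩ :=
      exists_measurable_superset_of_null (ae_iff.1 h.ae_price_ne_zero)
    refine ⟨Nᶜ, hNm.compl, ?_, by rwa [compl_compl]⟩
    rw [hR, Measure.map_map measurable_fst measurable_swap,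
      Measure.map_apply (measurable_fst.comp measurable_swap) hNm.compl]
    have hq : ∀ᵐ z ∂(ρ ⊗ₘ G), z.1 ∉ {y | q y ≠ 0} :=
      ae_compProd_of_ae_fst (ae_restrict_mem hpos.compl)
    refine measure_eq_zero_iff_ae_notMem.2 ?_
    filter_upwards [hRE, hq] with z hz hqz hzN
    exact hzN (hN fun hx => hqz (hx z.1 hz))
  refine ⟨⟨⟨?_⟩, ?_, hsnd⟩, fun t _ => ?_⟩
  · rw [← Set.preimage_univ (f := Prod.snd), ← Measure.map_apply measurable_snd .univ, hsnd]
    exact measure_lt_top _ _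
  · rw [Measure.add_apply, hR, Measure.map_apply measurable_swap h.measurableSet.compl,
      show (ρ ⊗ₘ G) (Prod.swap ⁻¹' Eᶜ) = 0 from ae_iff.1 hRE, add_zero]
    exact ae_iff.1 h.ae_compProd_mem
  · rw [h.Fit1_eq h']
    refine lintegral_congr_ae ?_
    have hd := Measure.eq_rnDeriv (measurable_mass (κ := κ)) hsing
      (μ := (μ ⊗ₘ κ + R).map Prod.fst)
      (by rw [Measure.map_add _ _ measurable_fst, map_fst_compProd, add_comm])
    filter_upwards [hd] with x hx
    rw [hx]

end Plan

end OptimalSide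

section Kernel

variable {μ : Measure X} [SFinite μ] (κ : Kernel X Y) [IsSFiniteKernel κ]

lemma measurable_map_prodMk : Measurable fun x => (κ x).map (Prod.mk x) := by
  refine Measure.measurable_of_measurable_coe _ fun A hA => ?_
  simp_rw [Measure.map_apply measurable_prodMk_left hA]
  exact Kernel.measurable_kernel_prodMk_left hA

lemma bind_map_prodMk : μ.bind (fun x => (κ x).map (Prod.mk x)) = μ ⊗ₘ κ := by
  ext A hA
  rw [Measure.bind_apply hA (measurable_map_prodMk κ).aemeasurable, Measure.compProd_apply hA]
  simp_rw [Measure.map_apply measurable_prodMk_left hA]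

lemma bind_map_prodMk_swap :
    μ.bind (fun x => (κ x).map (fun y => (y, x))) = (μ ⊗ₘ κ).map Prod.swap := by
  have hm : ∀ x, (κ x).map (fun y => (y, x)) = ((κ x).map (Prod.mk x)).map Prod.swap := fun x => by
    rw [Measure.map_map measurable_swap measurable_prodMk_left]
    rfl
  have hmeas : Measurable fun x => ((κ x).map (Prod.mk x)).map Prod.swap :=
    (Measure.measurable_map _ measurable_swap).comp (measurable_map_prodMk κ)
  ext A hA
  simp_rw [hm]
  rw [Measure.bind_apply hA hmeas.aemeasurable,
    ← bind_map_prodMk, Measure.map_apply measurable_swap hA,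
    Measure.bind_apply (measurable_swap hA) (measurable_map_prodMk κ).aemeasurable]
  simp_rw [Measure.map_apply measurable_swap hA]

omit [IsSFiniteKernel κ] in
/-- A kernel of finite measures is s-finite, even without a uniform bound on the masses. -/
lemma isSFiniteKernel_of_isFiniteMeasure [∀ x, IsFiniteMeasure (κ x)] : IsSFiniteKernel κ := by
  have hm : Measurable fun x => κ x Set.univ := κ.measurable_coe .univ
  let η : Kernel X Y :=
    { toFun := fun x => (κ x Set.univ)⁻¹ • κ x
      measurable' := Measure.measurable_of_measurable_coe _ fun A hA => by
        simp only [Measure.smul_apply, smul_eq_mul]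
        exact hm.inv.mul (κ.measurable_coe hA) }
  have hη : ∀ x, η x = (κ x Set.univ)⁻¹ • κ x := fun _ => rfl
  have : IsFiniteKernel η := ⟨⟨1, ENNReal.one_lt_top, fun x => by
    rw [hη, Measure.smul_apply, smul_eq_mul]
    exact ENNReal.inv_mul_le_one _⟩⟩
  have hu : Measurable (Function.uncurry fun (x : X) (_ : Y) => κ x Set.univ) :=
    hm.comp measurable_fst
  have hκ : κ = η.withDensity fun x _ => κ x Set.univ := by
    ext1 x
    rw [Kernel.withDensity_apply _ hu, withDensity_const, hη, smul_smul]
    rcases eq_or_ne (κ x Set.univ) 0 with h0 | h0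
    · simp [Measure.measure_univ_eq_zero.1 h0]
    · rw [ENNReal.mul_inv_cancel h0 (measure_ne_top _ _), one_smul]
  rw [hκ]
  exact Kernel.isSFiniteKernel_withDensity_of_isFiniteKernel η fun x _ => measure_ne_top _ _

end Kernel

section Swap

variable {E : Set (X × Y)} {μ : Measure X} {ν : Measure Y} {π : Measure (Y × X)} {t : ℝ}

lemma map_swap_mem_Plans0 (hE : MeasurableSet E) (h : π ∈ Plans1 (Prod.swap ⁻¹' E) μ) :
    π.map Prod.swap ∈ Plans0 E μ := by
  obtain ⟨hfin, hπE, hπ⟩ := h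
  refine ⟨inferInstance, ?_, ?_⟩
  · rwa [Measure.map_apply measurable_swap hE.compl]
  · rwa [Measure.map_map measurable_fst measurable_swap]

lemma map_swap_mem_Feas0 (hE : MeasurableSet E) (h : π ∈ Feas1 (Prod.swap ⁻¹' E) ν μ t) :
    π.map Prod.swap ∈ Feas0 E μ ν t := by
  obtain ⟨hfin, hπE, hπ0, hπ1⟩ := h
  refine ⟨inferInstance, ?_, ?_, ?_⟩
  · rwa [Measure.map_apply measurable_swap hE.compl]
  · rwa [Measure.map_map measurable_fst measurable_swap]
  · rwa [Measure.map_map measurable_snd measurable_swap]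

lemma map_swap_mem_Feas1 (hE : MeasurableSet E) {σ : Measure (X × Y)} (h : σ ∈ Feas0 E μ ν t) :
    σ.map Prod.swap ∈ Feas1 (Prod.swap ⁻¹' E) ν μ t := by
  obtain ⟨hfin, hσE, hσ0, hσ1⟩ := h
  refine ⟨inferInstance, ?_, ?_, ?_⟩
  · rwa [Measure.map_apply measurable_swap (measurable_swap hE).compl]
  · rwa [Measure.map_map measurable_snd measurable_swap]
  · rwa [Measure.map_map measurable_fst measurable_swap]

lemma Fit1_swap (hE : MeasurableSet E) : Fit1 (Prod.swap ⁻¹' E) ν μ t = Fit0 E μ ν t := by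
  refine le_antisymm (iSup₂_le fun σ hσ => ?_) (iSup₂_le fun σ hσ => ?_)
  · refine le_iSup₂_of_le (σ.map Prod.swap) (map_swap_mem_Feas0 hE hσ) ?_
    rw [Measure.map_apply measurable_swap .univ, Set.preimage_univ]
  · refine le_iSup₂_of_le (σ.map Prod.swap) (map_swap_mem_Feas1 hE hσ) ?_
    rw [Measure.map_apply measurable_swap .univ, Set.preimage_univ]

lemma levelOpt0_map_swap (hE : MeasurableSet E) (h : LevelOpt1 (Prod.swap ⁻¹' E) ν μ π) :
    LevelOpt0 E μ ν (π.map Prod.swap) := by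
  intro t ht
  rw [← Fit1_swap hE, ← h t ht, Measure.map_map measurable_snd measurable_swap]
  rfl

end Swap

section Walras

lemma measure_eq_indicator_of_compl_singleton {ρ : Measure X} {x : X} (h : ρ {x}ᶜ = 0)
    (B : Set X) : ρ B = B.indicator (fun _ => ρ Set.univ) x := by
  by_cases hx : x ∈ B
  · rw [Set.indicator_of_mem hx]
    refine measure_congr ?_
    filter_upwards [measure_eq_zero_iff_ae_notMem.1 h] with y hy
    have hy : y = x := by simpa using hy
    exact propext ⟨fun _ => trivial, fun _ => hy ▸ hx⟩
  · rw [Set.indicator_of_notMem hx]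
    exact measure_mono_null (fun y hy => by rintro rfl; exact hx hy) h

variable {T : Type} [MeasurableSpace T] {i : X → T} {j : Y → T}

/-- The kernel sending an agent `x` to the part of its bundle lying on the opposite side. -/
def bundleKernel (a : T → Measure T) (ha : Measurable a) (hi : Measurable i)
    (hj : MeasurableEmbedding j) : Kernel X Y where
  toFun x := (a (i x)).comap j
  measurable' := by
    refine Measure.measurable_of_measurable_coe _ fun B hB => ?_
    simp_rw [hj.comap_apply]
    exact (Measure.measurable_coe (hj.measurableSet_image.2 hB)).comp (ha.comp hi)

lemma lintegral_eq_add_comap (hi : MeasurableEmbedding i) (hj : MeasurableEmbedding j)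
    (hij : IsCompl (Set.range i) (Set.range j)) (z : Measure T) (p : T → ℝ≥0∞) :
    ∫⁻ t, p t ∂z = ∫⁻ x, p (i x) ∂(z.comap i) + ∫⁻ y, p (j y) ∂(z.comap j) := by
  rw [← lintegral_add_compl p hi.measurableSet_range, hij.compl_eq, ← hi.map_comap,
    ← hj.map_comap, hi.lintegral_map, hj.lintegral_map]

lemma comap_univ_lt_top (hj : MeasurableEmbedding j) (z : Measure T) [IsFiniteMeasure z] :
    z.comap j Set.univ < ⊤ := by
  rw [hj.comap_apply]
  exact measure_lt_top _ _

lemma optimalSide_of_equilibrium [MeasurableSingletonClass X] (hi : MeasurableEmbedding i)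
    (hj : MeasurableEmbedding j) (hij : IsCompl (Set.range i) (Set.range j))
    {E : Set (X × Y)} (hE : MeasurableSet E) (hne : ∀ x, ∃ y, (x, y) ∈ E)
    {μ : Measure X} {ν : Measure Y} {a : T → Measure T} {p : T → ℝ≥0∞}
    (hfin : ∀ t, IsFiniteMeasure (a t)) (ha : Measurable a)
    (hp : Measurable p ∧ ∃ C : ℝ≥0∞, C ≠ ⊤ ∧ ∀ t, p t ≤ C)
    (hcons : ∀ᵐ x ∂μ, (a (i x)).comap i {x}ᶜ = 0 ∧ (a (i x)).comap j {y | (x, y) ∈ E}ᶜ = 0)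
    (hret : ∀ᵐ y ∂ν, (a (j y)).comap j {y}ᶜ = 0)
    (hfeas : ∀ B, MeasurableSet B →
      ∫⁻ x, a (i x) (j '' B) ∂μ + ∫⁻ y, a (j y) (j '' B) ∂ν = ν B)
    (hopt : ∀ᵐ x ∂μ, ∫⁻ t, p t ∂(a (i x)) ≤ p (i x) ∧
      ¬ ∃ z : Measure T, (z.comap i {x}ᶜ = 0 ∧ z.comap j {y | (x, y) ∈ E}ᶜ = 0) ∧
        ∫⁻ t, p t ∂z ≤ p (i x) ∧
        (a (i x)).comap j {y | (x, y) ∈ E} < z.comap j {y | (x, y) ∈ E}) :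
    OptimalSide E μ ν (fun x => p (i x)) (fun y => p (j y)) (bundleKernel a ha hi.measurable hj)
      (fun x => (a (i x)).comap i Set.univ) (fun y => (a (j y)).comap j Set.univ) where
  measurableSet := hE
  exists_mem := hne
  measurable_price := hp.1.comp hi.measurable
  price_bdd := by
    obtain ⟨C, hC, hpC⟩ := hp.2
    exact ⟨C, hC, fun x => hpC _⟩
  finite x := (comap_univ_lt_top hj (a (i x))).ne
  budget := by
    filter_upwards [hcons, hopt] with x hx hb
    refine le_of_eq_of_le ?_ hb.1
    rw [lintegral_eq_add_comap hi hj hij]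
    have hxi : ∫⁻ x', p (i x') ∂((a (i x)).comap i) = ∫⁻ _, p (i x) ∂((a (i x)).comap i) := by
      refine lintegral_congr_ae ?_
      filter_upwards [measure_eq_zero_iff_ae_notMem.1 hx.1] with x' hx'
      have hx' : x' = x := by simpa using hx'
      rw [hx']
    rw [hxi, lintegral_const, mul_comm]
    rfl
  support := hcons.mono fun x hx => measure_eq_zero_iff_ae_notMem.1 hx.2 |>.mono fun y hy =>
    not_not.1 hy
  optimal := by
    filter_upwards [hopt] with x hx y hxy c hc
    by_contra hlt
    have hjy : j y ∉ Set.range i := fun hmem => Set.disjoint_left.1 hij.disjoint hmem ⟨y, rfl⟩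
    have hN : MeasurableSet {y | (x, y) ∈ E} := measurable_prodMk_left hE
    have hjN : j y ∉ j '' {y | (x, y) ∈ E}ᶜ := by
      rintro ⟨y', hy', he⟩
      exact hy' (hj.injective he ▸ hxy)
    have hjN' : j y ∈ j '' {y | (x, y) ∈ E} := ⟨y, hxy, rfl⟩
    refine hx.2 ⟨c • Measure.dirac (j y), ⟨?_, ?_⟩, ?_, ?_⟩
    · rw [hi.comap_apply, Measure.smul_apply, Measure.dirac_apply' _
        (hi.measurableSet_image.2 (measurableSet_singleton x).compl),
        Set.indicator_of_notMem fun hmem => hjy (Set.image_subset_range _ _ hmem), smul_zero]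
    · rw [hj.comap_apply, Measure.smul_apply, Measure.dirac_apply' _
        (hj.measurableSet_image.2 hN.compl),
        Set.indicator_of_notMem hjN, smul_zero]
    · rw [lintegral_smul_measure, lintegral_dirac' _ hp.1]
      exact hc
    · rw [hj.comap_apply (c • Measure.dirac (j y)), Measure.smul_apply, Measure.dirac_apply' _
        (hj.measurableSet_image.2 hN),
        Set.indicator_of_mem hjN']
      refine (measure_mono (Set.subset_univ _)).trans_lt ?_
      simp only [Pi.one_apply, smul_eq_mul, mul_one]
      exact lt_of_not_ge hlt
  clearing B hB := by
    rw [← hfeas B hB, ← lintegral_indicator hB]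
    congr 1
    · exact lintegral_congr fun x => hj.comap_apply _ _
    · refine lintegral_congr_ae ?_
      filter_upwards [hret] with y hy
      rw [← hj.comap_apply, measure_eq_indicator_of_compl_singleton hy]
      rfl

instance isSFiniteKernel_bundleKernel (a : T → Measure T) (ha : Measurable a)
    (hi : Measurable i) (hj : MeasurableEmbedding j) [∀ t, IsFiniteMeasure (a t)] :
    IsSFiniteKernel (bundleKernel a ha hi hj) :=
  have : ∀ x, IsFiniteMeasure (bundleKernel a ha hi hj x) := fun x =>
    ⟨comap_univ_lt_top hj (a (i x))⟩
  isSFiniteKernel_of_isFiniteMeasure _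

lemma measurable_of_measurable_integral {a : T → Measure T} [∀ t, IsFiniteMeasure (a t)]
    (h : ∀ f : T → ℝ, Measurable f → (∃ C : ℝ, ∀ t, |f t| ≤ C) →
      Measurable fun t => ∫ s, f s ∂(a t)) : Measurable a := by
  refine Measure.measurable_of_measurable_coe _ fun B hB => ?_
  have hB' := (h (B.indicator 1) (measurable_one.indicator hB) ⟨1, fun t => by
    by_cases ht : t ∈ B <;> simp [ht]⟩).ennreal_ofReal
  convert hB' using 2 with t
  rw [integral_indicator_one hB, ofReal_measureReal]

end Walras

section MuT

lemma measurableEmbedding_inl : MeasurableEmbedding (Sum.inl : X → X ⊕ Y) where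
  injective := Sum.inl_injective
  measurable := measurable_inl
  measurableSet_image' _ hA := measurableSet_inl_image.2 hA

lemma measurableEmbedding_inr : MeasurableEmbedding (Sum.inr : Y → X ⊕ Y) where
  injective := Sum.inr_injective
  measurable := measurable_inr
  measurableSet_image' _ hB := measurableSet_inr_image.2 hB

variable {μ : Measure X} {ν : Measure Y}

lemma ae_muT_iff {r : X ⊕ Y → Prop} :
    (∀ᵐ t ∂(muT μ ν), r t) ↔ (∀ᵐ x ∂μ, r (Sum.inl x)) ∧ ∀ᵐ y ∂ν, r (Sum.inr y) := by
  rw [muT, ae_add_measure_iff, measurableEmbedding_inl.ae_map_iff,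
    measurableEmbedding_inr.ae_map_iff]

lemma lintegral_muT (f : X ⊕ Y → ℝ≥0∞) :
    ∫⁻ t, f t ∂(muT μ ν) = ∫⁻ x, f (Sum.inl x) ∂μ + ∫⁻ y, f (Sum.inr y) ∂ν := by
  rw [muT, lintegral_add_measure, measurableEmbedding_inl.lintegral_map,
    measurableEmbedding_inr.lintegral_map]

lemma muT_inl_image (A : Set X) : muT μ ν (Sum.inl '' A) = μ A := by
  rw [muT, Measure.add_apply, measurableEmbedding_inl.map_apply,
    measurableEmbedding_inr.map_apply, Set.preimage_image_eq _ Sum.inl_injective,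
    Set.preimage_inr_image_inl, measure_empty, add_zero]

lemma muT_inr_image (B : Set Y) : muT μ ν (Sum.inr '' B) = ν B := by
  rw [muT, Measure.add_apply, measurableEmbedding_inl.map_apply,
    measurableEmbedding_inr.map_apply, Set.preimage_image_eq _ Sum.inr_injective,
    Set.preimage_inl_image_inr, measure_empty, zero_add]

variable {E : Set (X × Y)} {a : X ⊕ Y → Measure (X ⊕ Y)} {p : X ⊕ Y → ℝ≥0∞}

lemma optimalSide_inl_of_walras [MeasurableSingletonClass X] (hE : MeasurableSet E)
    (hne : ∀ x, ∃ y, (x, y) ∈ E) (hW : Walras E μ ν a p) (ha : Measurable a) :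
    OptimalSide E μ ν (fun x => p (Sum.inl x)) (fun y => p (Sum.inr y))
      (bundleKernel a ha measurable_inl measurableEmbedding_inr)
      (fun x => (a (Sum.inl x)).comap Sum.inl Set.univ)
      (fun y => (a (Sum.inr y)).comap Sum.inr Set.univ) := by
  obtain ⟨⟨hfin, -, hcons⟩, hfeas, hp, -, hopt⟩ := hW
  rw [ae_muT_iff] at hcons hopt
  refine optimalSide_of_equilibrium measurableEmbedding_inl measurableEmbedding_inr
    Set.isCompl_range_inl_range_inr hE hne hfin ha hp hcons.1
    (hcons.2.mono fun y hy => hy.1) (fun B hB => ?_) hopt.1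
  rw [← lintegral_muT fun t => a t (Sum.inr '' B),
    hfeas _ (measurableEmbedding_inr.measurableSet_image.2 hB), muT_inr_image]

lemma optimalSide_inr_of_walras [MeasurableSingletonClass Y] (hE : MeasurableSet E)
    (hne : ∀ y, ∃ x, (x, y) ∈ E) (hW : Walras E μ ν a p) (ha : Measurable a) :
    OptimalSide (Prod.swap ⁻¹' E) ν μ (fun y => p (Sum.inr y)) (fun x => p (Sum.inl x))
      (bundleKernel a ha measurable_inr measurableEmbedding_inl)
      (fun y => (a (Sum.inr y)).comap Sum.inr Set.univ)
      (fun x => (a (Sum.inl x)).comap Sum.inl Set.univ) := by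
  obtain ⟨⟨hfin, -, hcons⟩, hfeas, hp, -, hopt⟩ := hW
  rw [ae_muT_iff] at hcons hopt
  refine optimalSide_of_equilibrium measurableEmbedding_inr measurableEmbedding_inl
    Set.isCompl_range_inl_range_inr.symm (measurable_swap hE) hne hfin ha hp hcons.2
    (hcons.1.mono fun x hx => hx.1) (fun B hB => ?_) hopt.2
  rw [add_comm, ← lintegral_muT fun t => a t (Sum.inl '' B),
    hfeas _ (measurableEmbedding_inl.measurableSet_image.2 hB), muT_inl_image]

lemma tildePi1_eq_compProd [SFinite μ] [∀ t, IsFiniteMeasure (a t)] (ha : Measurable a)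
    (hs : ∀ᵐ x ∂μ, ∀ᵐ y ∂((a (Sum.inl x)).comap Sum.inr), (x, y) ∈ E) :
    tildePi1 E μ a = μ ⊗ₘ bundleKernel a ha measurable_inl measurableEmbedding_inr := by
  rw [← bind_map_prodMk]
  refine Measure.bind_congr_right ?_
  filter_upwards [hs] with x hx
  rw [Measure.restrict_eq_self_of_ae_mem (s := {y | (x, y) ∈ E}) hx]
  rfl

lemma tildePi0_eq_map_swap_compProd [SFinite ν] [∀ t, IsFiniteMeasure (a t)] (ha : Measurable a)
    (hs : ∀ᵐ y ∂ν, ∀ᵐ x ∂((a (Sum.inr y)).comap Sum.inl), (x, y) ∈ E) :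
    tildePi0 E ν a =
      (ν ⊗ₘ bundleKernel a ha measurable_inr measurableEmbedding_inl).map Prod.swap := by
  rw [← bind_map_prodMk_swap]
  refine Measure.bind_congr_right ?_
  filter_upwards [hs] with y hy
  rw [Measure.restrict_eq_self_of_ae_mem (s := {x | (x, y) ∈ E}) hy]
  rfl

end MuT

end TradingEconomy

theorem walras_to_level_opt_refinement_pair
    [TopologicalSpace Ω0] [PolishSpace Ω0] [BorelSpace Ω0]
    [TopologicalSpace Ω1] [PolishSpace Ω1] [BorelSpace Ω1]
    (E : Set (Ω0 × Ω1)) (hE : IsClosed E)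
    (ν0 : Measure Ω0) (ν1 : Measure Ω1) [IsFiniteMeasure ν0] [IsFiniteMeasure ν1]
    (hν0 : 0 < ν0 Set.univ) (hν1 : 0 < ν1 Set.univ)
    (hNbhd0 : ∀ x : Ω0, ∃ y : Ω1, (x, y) ∈ E) (hNbhd1 : ∀ y : Ω1, ∃ x : Ω0, (x, y) ∈ E)
    (a : (Ω0 ⊕ Ω1) → Measure (Ω0 ⊕ Ω1)) (p : (Ω0 ⊕ Ω1) → ℝ≥0∞)
    (hW : Walras E ν0 ν1 a p) :
    -- side 1
    ((tildePi1 E ν0 a).map Prod.snd ≤ ν1 ∧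
      ∀ G1 : Kernel Ω1 Ω0, IsMarkovKernel G1 →
        (∀ y : Ω1, G1 y {x : Ω0 | (x, y) ∈ E} = 1) →
        extractPi1 E ν0 ν1 a G1 ∈ Plans1 E ν1 ∧
          LevelOpt1 E ν0 ν1 (extractPi1 E ν0 ν1 a G1)) ∧
    -- side 0
    ((tildePi0 E ν1 a).map Prod.fst ≤ ν0 ∧
      ∀ G0 : Kernel Ω0 Ω1, IsMarkovKernel G0 →
        (∀ x : Ω0, G0 x {y : Ω1 | (x, y) ∈ E} = 1) →
        extractPi0 E ν0 ν1 a G0 ∈ Plans0 E ν0 ∧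
          LevelOpt0 E ν0 ν1 (extractPi0 E ν0 ν1 a G0)) := by
  have hEm : MeasurableSet E := hE.measurableSet
  have hfin := hW.1.1
  have ha : Measurable a := TradingEconomy.measurable_of_measurable_integral hW.1.2.1
  have h := TradingEconomy.optimalSide_inl_of_walras hEm hNbhd0 hW ha
  have h' := TradingEconomy.optimalSide_inr_of_walras hEm hNbhd1 hW ha
  have hswap : Prod.swap ⁻¹' (Prod.swap ⁻¹' E) = E := by ext; rfl
  have h'' := hswap.symm ▸ h
  have hT1 := TradingEconomy.tildePi1_eq_compProd ha h.support
  have hT0 := TradingEconomy.tildePi0_eq_map_swap_compProd (E := E) ha h'.support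
  have hfst : (tildePi0 E ν1 a).map Prod.fst = (ν1 ⊗ₘ TradingEconomy.bundleKernel a ha
      measurable_inr TradingEconomy.measurableEmbedding_inl).map Prod.snd := by
    rw [hT0, Measure.map_map measurable_fst measurable_swap]
    rfl
  refine ⟨⟨?_, fun G1 _ hG1 => ?_⟩, ?_, fun G0 _ hG0 => ?_⟩
  · rw [hT1]
    exact h.map_snd_compProd_le h'
  · rw [extractPi1, TradingEconomy.bind_map_prodMk_swap, hT1]
    exact h.extract_mem_Plans1_and_levelOpt1 h' G1 hG1
  · rw [hfst]
    exact h'.map_snd_compProd_le h''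
  · have hπ := h'.extract_mem_Plans1_and_levelOpt1 h'' G0 hG0
    have hextract : extractPi0 E ν0 ν1 a G0 = (ν1 ⊗ₘ TradingEconomy.bundleKernel a ha
        measurable_inr TradingEconomy.measurableEmbedding_inl + ((ν0 - (ν1 ⊗ₘ TradingEconomy.bundleKernel a ha
          measurable_inr TradingEconomy.measurableEmbedding_inl).map Prod.snd) ⊗ₘ G0).map Prod.swap).map
        Prod.swap := by
      rw [Measure.map_add _ _ measurable_swap, Measure.map_map measurable_swap measurable_swap,
        Prod.swap_swap_eq, Measure.map_id, extractPi0, TradingEconomy.bind_map_prodMk, hfst, hT0]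
    rw [hextract]
    exact ⟨TradingEconomy.map_swap_mem_Plans0 hEm hπ.1,
      TradingEconomy.levelOpt0_map_swap hEm hπ.2⟩
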